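/- Let n ≥ 3 be an integer with n ≡ 1 (mod 3), and let T be a perfect tiling subset of G for parameter n. Then for every g ∈ G with g ≠ e, the number of pairs (t₁,t₂) ∈ T × T with t₁·t₂³ = g is at most n + 2 (i.e., g appears at most n + 2 times in the group-ring product T·T^(3)). -/

import Mathlib

/-- `T` is a perfect tiling subset of `G` for parameter `n`:
`|G| = 2n²+1`, `|T| = 2n+1`, `e ∈ T`, `T = T⁽⁻¹⁾`, and
`T·T = 2·G + T⁽²⁾ + (2n-2)·e` in the integral group ring `ℤ[G]`. -/
def IsPerfectTilingSubset (n : ℕ) {G : Type} [CommGroup G] [Fintype G] [DecidableEq G]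
    (T : Finset G) : Prop :=
  Fintype.card G = 2 * n ^ 2 + 1 ∧
  T.card = 2 * n + 1 ∧
  (1 : G) ∈ T ∧
  T = T.image (·⁻¹) ∧
  (∑ t ∈ T, MonoidAlgebra.single t (1 : ℤ)) * (∑ t ∈ T, MonoidAlgebra.single t (1 : ℤ))
    = 2 * (∑ g : G, MonoidAlgebra.single g (1 : ℤ))
      + (∑ t ∈ T, MonoidAlgebra.single (t ^ 2) (1 : ℤ))
      + MonoidAlgebra.single (1 : G) (2 * (n : ℤ) - 2)

open Finset in
lemma coeff_sum_single_card {G ι : Type} [DecidableEq G] (I : Finset ι) (a : ι → G) (x : G) :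
    (∑ i ∈ I, MonoidAlgebra.single (a i) (1 : ℤ)).coeff x = ((I.filter (fun i => a i = x)).card : ℤ) := by
  rw [MonoidAlgebra.coeff_sum, Finsupp.finsetSum_apply]
  simp [MonoidAlgebra.coeff_single, Finsupp.single_apply]

lemma cube_sum_mod {R ι : Type} [CommRing R] [DecidableEq ι] (I : Finset ι) (f : ι → R) :
    ∃ y : R, (∑ i ∈ I, f i) ^ 3 = ∑ i ∈ I, f i ^ 3 + (y + y + y) := by
  induction I using Finset.induction_on with
  | empty => exact ⟨0, by simp⟩
  | insert a s ha ih =>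
    obtain ⟨y, hy⟩ := ih
    rw [Finset.sum_insert ha, Finset.sum_insert ha]
    refine ⟨y + f a ^ 2 * (∑ i ∈ s, f i) + f a * (∑ i ∈ s, f i) ^ 2, ?_⟩
    linear_combination hy

lemma sum_single_mul {G : Type} [CommGroup G] (T : Finset G) (a b : G → G) :
    (∑ t ∈ T, MonoidAlgebra.single (a t) (1 : ℤ)) * (∑ t ∈ T, MonoidAlgebra.single (b t) (1 : ℤ))
      = ∑ p ∈ T ×ˢ T, MonoidAlgebra.single (a p.1 * b p.2) (1 : ℤ) := by
  rw [Finset.sum_mul_sum, Finset.sum_product]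
  simp [MonoidAlgebra.single_mul_single]

lemma all_mul {G : Type} [CommGroup G] [Fintype G] (T : Finset G) (b : G → G) :
    (∑ g : G, MonoidAlgebra.single g (1 : ℤ)) * (∑ t ∈ T, MonoidAlgebra.single (b t) (1 : ℤ))
      = (T.card : MonoidAlgebra ℤ G) * (∑ g : G, MonoidAlgebra.single g (1 : ℤ)) := by
  rw [Finset.mul_sum]
  have : ∀ t ∈ T, (∑ g : G, MonoidAlgebra.single g (1 : ℤ)) * MonoidAlgebra.single (b t) (1 : ℤ)
      = ∑ g : G, MonoidAlgebra.single g (1 : ℤ) := by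
    intro t _
    rw [Finset.sum_mul]
    simp only [MonoidAlgebra.single_mul_single, mul_one]
    exact Fintype.sum_equiv (Equiv.mulRight (b t)) _ _ (fun x => rfl)
  rw [Finset.sum_congr rfl this]
  simp

lemma coeff_nat_mul {G : Type} [CommGroup G] (k : ℕ) (y : MonoidAlgebra ℤ G) (x : G) :
    ((k : MonoidAlgebra ℤ G) * y).coeff x = k * y.coeff x := by
  rw [← nsmul_eq_mul, MonoidAlgebra.coeff_smul, Finsupp.smul_apply, nsmul_eq_mul]

lemma coeff_single_one_mul {G : Type} [CommGroup G] (k : ℤ) (y : MonoidAlgebra ℤ G) (x : G) :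
    (MonoidAlgebra.single 1 k * y).coeff x = k * y.coeff x := by
  simp

lemma coeff_all {G : Type} [CommGroup G] [Fintype G] (x : G) :
    (∑ g : G, MonoidAlgebra.single g (1 : ℤ)).coeff x = 1 := by
  classical
  rw [coeff_sum_single_card]
  have : (Finset.univ.filter (fun i : G => i = x)) = {x} := by
    ext i
    simp
  rw [this]
  simp

theorem stmt8 (n : ℕ) (hn : 3 ≤ n) (hmod : n % 3 = 1)
    {G : Type} [CommGroup G] [Fintype G] [DecidableEq G]
    (T : Finset G) (hT : IsPerfectTilingSubset n T) :
    ∀ g : G, g ≠ 1 →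
      ((T ×ˢ T).filter (fun p => p.1 * p.2 ^ 3 = g)).card ≤ n + 2 := by
  obtain ⟨hG, hTc, h1, hinv, hTT⟩ := hT
  have hinvm : ∀ t ∈ T, t⁻¹ ∈ T := by
    intro t ht
    rw [hinv]
    exact Finset.mem_image_of_mem _ ht
  have hsq : ∀ a b : G, a ^ 2 = b ^ 2 → a = b := by
    intro a b h
    have hc : (Nat.card G).Coprime 2 := by
      rw [Nat.card_eq_fintype_card, hG, Nat.coprime_two_right]
      exact ⟨n ^ 2, rfl⟩
    exact (powCoprime hc).injective h
  set A : MonoidAlgebra ℤ G := ∑ t ∈ T, MonoidAlgebra.single t (1 : ℤ) with hA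
  set B : MonoidAlgebra ℤ G := ∑ t ∈ T, MonoidAlgebra.single (t ^ 2) (1 : ℤ) with hB
  set S : MonoidAlgebra ℤ G := ∑ g : G, MonoidAlgebra.single g (1 : ℤ) with hS
  let c : G → ℕ := fun x => ((T ×ˢ T).filter (fun p => p.1 * p.2 ^ 2 = x)).card
  let r : G → ℕ := fun x => ((T ×ˢ T).filter (fun p => p.1 * p.2 = x)).card
  let q : G → ℕ := fun x => ((T ×ˢ T).filter (fun p => p.1 ^ 2 * p.2 ^ 2 = x)).card
  let m : G → ℕ := fun x => (T.filter (fun s => s ^ 3 = x)).card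
  let b : G → ℕ := fun x => (T.filter (fun s => s ^ 2 = x)).card
  have hAA : A * A = ∑ p ∈ T ×ˢ T, MonoidAlgebra.single (p.1 * p.2) (1 : ℤ) :=
    sum_single_mul T (fun t => t) (fun t => t)
  have hAB : A * B = ∑ p ∈ T ×ˢ T, MonoidAlgebra.single (p.1 * p.2 ^ 2) (1 : ℤ) :=
    sum_single_mul T (fun t => t) (fun t => t ^ 2)
  have hBB : B * B = ∑ p ∈ T ×ˢ T, MonoidAlgebra.single (p.1 ^ 2 * p.2 ^ 2) (1 : ℤ) :=
    sum_single_mul T (fun t => t ^ 2) (fun t => t ^ 2)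
  have hSA : S * A = ((2 * n + 1 : ℕ) : MonoidAlgebra ℤ G) * S := by
    rw [← hTc]; exact all_mul T (fun t => t)
  have hSB : S * B = ((2 * n + 1 : ℕ) : MonoidAlgebra ℤ G) * S := by
    rw [← hTc]; exact all_mul T (fun t => t ^ 2)
  have hSx : ∀ x, S.coeff x = 1 := fun x => coeff_all x
  have hBx : ∀ x, B.coeff x = b x := fun x => coeff_sum_single_card T _ x
  have hb1 : ∀ x, b x ≤ 1 := by
    intro x
    refine Finset.card_le_one.2 ?_
    intro u hu v hv
    simp only [Finset.mem_filter] at hu hv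
    exact hsq _ _ (hu.2.trans hv.2.symm)
  -- representation numbers
  have hr : ∀ x, x ≠ 1 → r x ≤ 3 := by
    intro x hx
    have h := congrArg (fun y => y.coeff x) hTT
    have h2 : (2 : MonoidAlgebra ℤ G) = ((2 : ℕ) : MonoidAlgebra ℤ G) := Nat.cast_two.symm
    rw [hAA, coeff_sum_single_card, MonoidAlgebra.coeff_add, MonoidAlgebra.coeff_add,
      Finsupp.add_apply, Finsupp.add_apply, hBx, h2, coeff_nat_mul, hSx,
      MonoidAlgebra.coeff_single, Finsupp.single_apply, if_neg hx.symm] at h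
    have := hb1 x
    change ((r x : ℕ) : ℤ) = _ at h
    push_cast at h
    omega
  have hq : ∀ x, x ≠ 1 → q x ≤ 3 := by
    intro x hx
    by_cases hq0 : q x = 0
    · omega
    obtain ⟨p, hp⟩ := Finset.card_pos.1 (Nat.pos_of_ne_zero hq0)
    simp only [Finset.mem_filter] at hp
    have hy : p.1 * p.2 ≠ 1 := by
      intro h
      apply hx
      rw [← hp.2, ← mul_pow, h, one_pow]
    refine le_trans (Finset.card_le_card ?_) (hr _ hy)
    intro z hz
    simp only [Finset.mem_filter] at hz ⊢
    refine ⟨hz.1, hsq _ _ ?_⟩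
    rw [mul_pow, mul_pow, hz.2, hp.2]
  -- congruence mod 3
  have hmod3 : ∀ x, c x % 3 = m x % 3 := by
    intro x
    obtain ⟨y, hy⟩ := cube_sum_mod T (fun t => MonoidAlgebra.single t (1 : ℤ))
    have h3 : A ^ 3 = ((2 : ℕ) : MonoidAlgebra ℤ G) * (((2 * n + 1 : ℕ) : MonoidAlgebra ℤ G) * S)
        + A * B + MonoidAlgebra.single 1 (2 * (n : ℤ) - 2) * A := by
      rw [pow_succ, pow_two, hTT, ← hSA]
      push_cast
      ring
    have h4 : A ^ 3 = ∑ t ∈ T, MonoidAlgebra.single (t ^ 3) (1 : ℤ) + (y + y + y) := by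
      rw [hA, hy]
      simp [MonoidAlgebra.single_pow]
    have h := congrArg (fun y => y.coeff x) (h3.symm.trans h4)
    simp only [MonoidAlgebra.coeff_add, Finsupp.add_apply] at h
    rw [coeff_nat_mul, coeff_nat_mul, hSx, hAB, coeff_sum_single_card, coeff_sum_single_card,
      coeff_single_one_mul] at h
    change _ + ((c x : ℕ) : ℤ) + _ = ((m x : ℕ) : ℤ) + _ at h
    obtain ⟨k, hk⟩ : ∃ k, n = 3 * k + 1 := ⟨n / 3, by omega⟩
    subst hk
    push_cast at h
    have e : (2 * (3 * (k : ℤ) + 1) - 2) * A.coeff x = 3 * (2 * k * A.coeff x) := by ring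
    rw [e] at h
    generalize 2 * (k : ℤ) * A.coeff x = w at h
    omega
  -- the total
  have htot : ∀ g, ∑ t ∈ T, (c (t⁻¹ * g) : ℤ)
      = 2 * (2 * n + 1) + q g + (2 * n - 2) * b g := by
    intro g
    have h3 : A * (A * B) = ((2 : ℕ) : MonoidAlgebra ℤ G) * (((2 * n + 1 : ℕ) : MonoidAlgebra ℤ G) * S)
        + B * B + MonoidAlgebra.single 1 (2 * (n : ℤ) - 2) * B := by
      rw [← mul_assoc, hTT, ← hSB]
      push_cast
      ring
    have h := congrArg (fun y => y.coeff g) h3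
    simp only [MonoidAlgebra.coeff_add, Finsupp.add_apply] at h
    rw [coeff_nat_mul, coeff_nat_mul, hSx, hBB, coeff_sum_single_card,
      coeff_single_one_mul, hBx, hAB, hA, Finset.sum_mul, MonoidAlgebra.coeff_sum,
      Finsupp.finsetSum_apply] at h
    push_cast at h
    rw [mul_one] at h
    rw [← h]
    refine Finset.sum_congr rfl fun t _ => ?_
    rw [MonoidAlgebra.coeff_single_mul_apply, one_mul, coeff_sum_single_card]
  -- lower bounds
  have hlow0 : ∀ x, m x ≤ c x := by
    intro x
    refine Finset.card_le_card_of_injOn (fun s => (s, s)) ?_ ?_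
    · intro s hs
      simp only [Finset.coe_filter, Set.mem_ofPred_eq, Finset.mem_product] at hs ⊢
      exact ⟨⟨hs.1, hs.1⟩, by rw [← hs.2]; exact (pow_succ' s 2).symm⟩
    · intro s _ t _ h
      exact (Prod.mk.inj h).1
  have hlow : ∀ x a t, a ∈ T → t ∈ T → a ≠ t → a * t ^ 2 = x → m x + 3 ≤ c x := by
    intro x a t ha ht hat hx
    have : m x < c x := by
      have hi : (T.filter (fun s => s ^ 3 = x)).image (fun s => (s, s)) ⊂
          (T ×ˢ T).filter (fun p => p.1 * p.2 ^ 2 = x) := by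
        rw [Finset.ssubset_iff_of_subset]
        · refine ⟨(a, t), ?_, ?_⟩
          · simp [ha, ht, hx]
          · intro h
            simp only [Finset.mem_image, Prod.mk.injEq] at h
            obtain ⟨s, -, h1, h2⟩ := h
            exact hat (h1.symm.trans h2)
        · intro p hp
          simp only [Finset.mem_image, Finset.mem_filter] at hp
          obtain ⟨s, hs, rfl⟩ := hp
          simp only [Finset.mem_filter, Finset.mem_product]
          exact ⟨⟨hs.1, hs.1⟩, by rw [← hs.2]; exact (pow_succ' s 2).symm⟩
      have := Finset.card_lt_card hi
      rwa [Finset.card_image_of_injective _ (fun s t h => (Prod.mk.inj h).1)] at this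
    have := hmod3 x
    omega
  intro g hg
  set N := ((T ×ˢ T).filter (fun p => p.1 * p.2 ^ 3 = g)).card with hN
  have hNm : ∑ t ∈ T, m (t⁻¹ * g) = N := by
    rw [hN, Finset.card_filter, Finset.sum_product]
    refine Finset.sum_congr rfl fun t _ => ?_
    rw [← Finset.card_filter]
    simp only [m, eq_inv_mul_iff_mul_eq]
  let P := T.filter (fun t => g * (t ^ 3)⁻¹ ∈ T)
  have hNP : P.card = N := by
    rw [hN]
    refine Finset.card_nbij' (fun t => (g * (t ^ 3)⁻¹, t)) (fun p => p.2) ?_ ?_ ?_ ?_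
    · intro t ht
      simp only [P, Finset.coe_filter, Set.mem_ofPred_eq, Finset.mem_product] at ht ⊢
      exact ⟨⟨ht.2, ht.1⟩, by group⟩
    · intro p hp
      simp only [P, Finset.coe_filter, Set.mem_ofPred_eq, Finset.mem_product] at hp ⊢
      refine ⟨hp.1.2, ?_⟩
      rw [← hp.2, mul_inv_cancel_right]
      exact hp.1.1
    · intro t _
      rfl
    · intro p hp
      simp only [Finset.coe_filter, Set.mem_ofPred_eq, Finset.mem_product] at hp
      rw [← hp.2]
      simp
  have ht := htot g
  have hq3 := hq g hg
  have hNm' : ∑ t ∈ T, (m (t⁻¹ * g) : ℤ) = N := by exact_mod_cast hNm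
  by_cases hbg : b g = 0
  · -- first case
    let E := P.filter (fun t => t ^ 4 ≠ g)
    have hE : P.card ≤ E.card + 1 := by
      rw [← Finset.card_filter_add_card_filter_not (s := P) (fun t => t ^ 4 ≠ g)]
      refine Nat.add_le_add_left (Finset.card_le_one.2 ?_) _
      intro u hu v hv
      simp only [Finset.mem_filter, not_not] at hu hv
      apply hsq; apply hsq
      rw [← pow_mul, ← pow_mul]
      exact hu.2.trans hv.2.symm
    have hsum : ∑ t ∈ T, ((m (t⁻¹ * g) : ℤ) + if t ∈ E then 3 else 0) ≤ ∑ t ∈ T, (c (t⁻¹ * g) : ℤ) := by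
      refine Finset.sum_le_sum fun t htT => ?_
      split_ifs with h
      · simp only [E, P, Finset.mem_filter] at h
        have := hlow (t⁻¹ * g) (g * (t ^ 3)⁻¹) t h.1.2 h.1.1 (by
          intro h'
          apply h.2
          rw [pow_succ' t 3]
          nth_rewrite 1 [← h']
          group) (by
            rw [pow_succ t 2, mul_inv, mul_assoc, mul_right_comm, inv_mul_cancel, one_mul, mul_comm])
        exact_mod_cast this
      · have := hlow0 (t⁻¹ * g)
        simpa using this
    rw [Finset.sum_add_distrib, hNm', ← Finset.sum_filter, ht, hbg] at hsum
    have hET : T.filter (fun t => t ∈ E) = E := by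
      ext t
      simp only [Finset.mem_filter, E, P]
      tauto
    rw [hET, Finset.sum_const] at hsum
    simp only [nsmul_eq_mul] at hsum
    push_cast at hsum
    omega
  · obtain ⟨u, hu⟩ := Finset.card_pos.1 (Nat.pos_of_ne_zero hbg)
    simp only [Finset.mem_filter] at hu
    have hb : b g = 1 := by have := hb1 g; omega
    have hsum : ∑ t ∈ T, ((m (t⁻¹ * g) : ℤ) + if t ∈ T.erase u⁻¹ then 3 else 0)
        ≤ ∑ t ∈ T, (c (t⁻¹ * g) : ℤ) := by
      refine Finset.sum_le_sum fun t htT => ?_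
      split_ifs with h
      · rw [Finset.mem_erase] at h
        have := hlow (t⁻¹ * g) t⁻¹ u (hinvm t h.2) hu.1 (by
          intro h'
          exact h.1 (by rw [← h', inv_inv])) (by rw [hu.2])
        exact_mod_cast this
      · have := hlow0 (t⁻¹ * g)
        simpa using this
    have hET : T.filter (fun t => t ∈ T.erase u⁻¹) = T.erase u⁻¹ := by
      ext t
      simp only [Finset.mem_filter, Finset.mem_erase]
      tauto
    rw [Finset.sum_add_distrib, hNm', ← Finset.sum_filter, ht, hb, hET, Finset.sum_const,
      Finset.card_erase_of_mem (hinvm u hu.1), hTc] at hsum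
    simp only [nsmul_eq_mul] at hsum
    push_cast at hsum
    omega
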